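/- arXiv:1803.08661 — 5 statements merged into one kernel-verified Lean document; each statement's English description precedes it below -/
import Mathlib

section
/- Let A ⊆ ℝ^d be a nonempty compact set, U ⊆ ℝ^m an open set, a : A → ℝ continuous, and σ : A × U → ℝ continuous such that for each x' ∈ A the map u ↦ σ(x', u) is differentiable, with gradient ∇_u σ(x', u) jointly continuous on A × U. Fix u₀ ∈ U and suppose that for γ-almost every z ∈ ℝ the maximizer over A of x' ↦ a(x') + σ(x', u₀)·z is unique, and let Y : ℝ → A be a measurable map such that for γ-almost every z, Y(z) is this unique maximizer. Then the function V(u) := ∫_ℝ max_{x' ∈ A} ( a(x') + σ(x', u)·z ) dγ(z) is differentiable at u₀, and ∇V(u₀) = ∫_ℝ z · ∇_u σ(Y(z), u₀) dγ(z). -/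
open MeasureTheory ProbabilityTheory


lemma voi_sSup_ge {E : Type*} [TopologicalSpace E] {A : Set E} (hA : IsCompact A)
    {f : E → ℝ} (hf : ContinuousOn f A) {x : E} (hx : x ∈ A) : f x ≤ sSup (f '' A) :=
  le_csSup (hA.image_of_continuousOn hf).bddAbove (Set.mem_image_of_mem f hx)

lemma voi_sSup_attained {E : Type*} [TopologicalSpace E] {A : Set E} (hA : IsCompact A)
    (hne : A.Nonempty) {f : E → ℝ} (hf : ContinuousOn f A) : ∃ x ∈ A, sSup (f '' A) = f x := by
  obtain ⟨x, hx, h⟩ := (hA.image_of_continuousOn hf).sSup_mem (hne.image f)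
  exact ⟨x, hx, h.symm⟩

lemma voi_sSup_sub_le {E : Type*} [TopologicalSpace E] {A : Set E} (hA : IsCompact A)
    (hne : A.Nonempty) {f g : E → ℝ} (hf : ContinuousOn f A) (hg : ContinuousOn g A) {c : ℝ}
    (h : ∀ x ∈ A, |f x - g x| ≤ c) : |sSup (f '' A) - sSup (g '' A)| ≤ c := by
  obtain ⟨x, hx, hfx⟩ := voi_sSup_attained hA hne hf
  obtain ⟨y, hy, hgy⟩ := voi_sSup_attained hA hne hg
  have h1 := voi_sSup_ge hA hf hy
  have h2 := voi_sSup_ge hA hg hx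
  have h3 := abs_le.1 (h x hx)
  have h4 := abs_le.1 (h y hy)
  rw [abs_le]
  constructor <;> linarith

/-- Envelope-theorem formula for the gradient of the value of information: with `γ` the standard
Gaussian measure on `ℝ`, `A ⊆ ℝ^d` nonempty compact, `U ⊆ ℝ^m` open, `a` continuous on `A`, `σ`
continuous on `A × U` and differentiable in `u` with jointly continuous gradient, and `Y z` the
(γ-a.e. unique) maximizer over `A` of `x' ↦ a x' + σ x' u₀ * z`, the function
`V u = ∫ max_{x'∈A}(a x' + σ x' u * z) dγ(z)` is differentiable at `u₀` with derivative
`∫ z • ∇ᵤσ(Y z, u₀) dγ(z)`. -/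
theorem envelope_gradient_of_voi
    {d m : ℕ}
    (A : Set (EuclideanSpace ℝ (Fin d))) (hA_compact : IsCompact A) (hA_ne : A.Nonempty)
    (U : Set (EuclideanSpace ℝ (Fin m))) (hU : IsOpen U)
    (a : EuclideanSpace ℝ (Fin d) → ℝ) (ha : ContinuousOn a A)
    (σ : EuclideanSpace ℝ (Fin d) → EuclideanSpace ℝ (Fin m) → ℝ)
    (hσ_cont : ContinuousOn
      (fun q : EuclideanSpace ℝ (Fin d) × EuclideanSpace ℝ (Fin m) => σ q.1 q.2) (A ×ˢ U))
    (hσ_diff : ∀ x' ∈ A, ∀ u ∈ U, DifferentiableAt ℝ (σ x') u)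
    (hσ_grad_cont : ContinuousOn
      (fun q : EuclideanSpace ℝ (Fin d) × EuclideanSpace ℝ (Fin m) =>
        fderiv ℝ (σ q.1) q.2) (A ×ˢ U))
    (u₀ : EuclideanSpace ℝ (Fin m)) (hu₀ : u₀ ∈ U)
    (Y : ℝ → EuclideanSpace ℝ (Fin d)) (hY_meas : Measurable Y)
    (hY : ∀ᵐ z ∂(gaussianReal 0 1),
      Y z ∈ A ∧ (∀ y ∈ A, a y + σ y u₀ * z ≤ a (Y z) + σ (Y z) u₀ * z) ∧
        ∀ y ∈ A, (∀ y' ∈ A, a y' + σ y' u₀ * z ≤ a y + σ y u₀ * z) → y = Y z) :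
    HasFDerivAt
      (fun u => ∫ z, sSup ((fun x' => a x' + σ x' u * z) '' A) ∂(gaussianReal 0 1))
      (∫ z, z • fderiv ℝ (σ (Y z)) u₀ ∂(gaussianReal 0 1)) u₀ := by
  obtain ⟨r, hr, hrU⟩ := Metric.nhds_basis_closedBall.mem_iff.1 (hU.mem_nhds hu₀)
  set B := Metric.closedBall u₀ r with hB
  have hBc : IsCompact B := isCompact_closedBall u₀ r
  have hu₀B : u₀ ∈ B := Metric.mem_closedBall_self hr.le
  have hsub : A ×ˢ B ⊆ A ×ˢ U := Set.prod_mono le_rfl hrU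
  obtain ⟨C, hC⟩ := (hA_compact.prod hBc).exists_bound_of_continuousOn (hσ_grad_cont.mono hsub)
  obtain ⟨S, hS⟩ := (hA_compact.prod hBc).exists_bound_of_continuousOn (hσ_cont.mono hsub)
  obtain ⟨K, hK⟩ := hA_compact.exists_bound_of_continuousOn ha
  have hC' : ∀ x ∈ A, ∀ u ∈ B, ‖fderiv ℝ (σ x) u‖ ≤ C := fun x hx u hu => hC (x, u) ⟨hx, hu⟩
  have hS' : ∀ x ∈ A, ∀ u ∈ B, |σ x u| ≤ S := fun x hx u hu => hS (x, u) ⟨hx, hu⟩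
  have hK' : ∀ x ∈ A, |a x| ≤ K := fun x hx => hK x hx
  have hσc : ∀ u ∈ B, ContinuousOn (fun x => σ x u) A := fun u hu =>
    hσ_cont.comp (f := fun x => (x, u)) (by fun_prop) (fun x hx => ⟨hx, hrU hu⟩)
  have hfc : ∀ u ∈ B, ∀ z : ℝ, ContinuousOn (fun x => a x + σ x u * z) A := fun u hu z =>
    ha.add ((hσc u hu).mul continuousOn_const)
  have hlip : ∀ x ∈ A, ∀ u ∈ B, |σ x u - σ x u₀| ≤ C * ‖u - u₀‖ := fun x hx u hu =>
    (convex_closedBall u₀ r).norm_image_sub_le_of_norm_fderiv_le (𝕜 := ℝ)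
      (fun v hv => hσ_diff x hx v (hrU hv)) (fun v hv => hC' x hx v hv) hu₀B hu
  have hliz : ∀ z : ℝ, ∀ x ∈ A, ∀ u ∈ B,
      |(a x + σ x u * z) - (a x + σ x u₀ * z)| ≤ C * |z| * ‖u - u₀‖ := by
    intro z x hx u hu
    have : (a x + σ x u * z) - (a x + σ x u₀ * z) = (σ x u - σ x u₀) * z := by ring
    rw [this, abs_mul]
    nlinarith [mul_le_mul_of_nonneg_right (hlip x hx u hu) (abs_nonneg z)]
  have hMcont : ∀ u ∈ B, Continuous (fun z : ℝ => sSup ((fun x' => a x' + σ x' u * z) '' A)) := by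
    intro u hu
    have : LipschitzWith (Real.toNNReal S)
        (fun z : ℝ => sSup ((fun x' => a x' + σ x' u * z) '' A)) := by
      apply LipschitzWith.of_dist_le'
      intro z w
      rw [Real.dist_eq, Real.dist_eq]
      apply voi_sSup_sub_le hA_compact hA_ne (hfc u hu z) (hfc u hu w)
      intro x hx
      have : (a x + σ x u * z) - (a x + σ x u * w) = σ x u * (z - w) := by ring
      rw [this, abs_mul]
      exact mul_le_mul_of_nonneg_right (hS' x hx u hu) (abs_nonneg _)
    exact this.continuous
  have hid : Integrable (fun z : ℝ => z) (gaussianReal 0 1) :=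
    (memLp_id_gaussianReal (μ := 0) (v := 1) 1).integrable (by simp)
  refine (hasFDerivAt_integral_of_dominated_loc_of_lip' (𝕜 := ℝ)
    (F := fun u z => sSup ((fun x' => a x' + σ x' u * z) '' A))
    (F' := fun z => z • fderiv ℝ (σ (Y z)) u₀) (bound := fun z => C * |z|)
    (Metric.closedBall_mem_nhds u₀ hr) ?_ ?_ ?_ ?_ ?_ ?_).2
  · exact fun u hu => (hMcont u hu).aestronglyMeasurable
  · refine Integrable.mono' ((integrable_const K).add (hid.abs.const_mul S))
      (hMcont u₀ hu₀B).aestronglyMeasurable (Filter.Eventually.of_forall fun z => ?_)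
    obtain ⟨x, hx, h⟩ := voi_sSup_attained hA_compact hA_ne (hfc u₀ hu₀B z)
    simp only [h, Real.norm_eq_abs, Pi.add_apply]
    refine (abs_add_le _ _).trans (add_le_add (hK' x hx) ?_)
    rw [abs_mul]
    exact mul_le_mul_of_nonneg_right (hS' x hx u₀ hu₀B) (abs_nonneg _)
  · classical
    have hG : ContinuousOn (fun x => fderiv ℝ (σ x) u₀) A :=
      hσ_grad_cont.comp (f := fun x => (x, u₀)) (by fun_prop) (fun x hx => ⟨hx, hu₀⟩)
    have hGm : Measurable (A.piecewise (fun x => fderiv ℝ (σ x) u₀) (fun _ => 0)) :=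
      hG.measurable_piecewise continuousOn_const hA_compact.isClosed.measurableSet
    have h2 : Measurable (fun z : ℝ =>
        z • A.piecewise (fun x => fderiv ℝ (σ x) u₀) (fun _ => 0) (Y z)) :=
      measurable_id.smul (hGm.comp hY_meas)
    refine h2.aestronglyMeasurable.congr ?_
    filter_upwards [hY] with z hz
    simp [Set.piecewise, hz.1]
  · refine Filter.Eventually.of_forall fun z u hu => ?_
    exact voi_sSup_sub_le hA_compact hA_ne (hfc u hu z) (hfc u₀ hu₀B z)
      (fun x hx => hliz z x hx u hu)
  · exact hid.abs.const_mul C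
  · filter_upwards [hY] with z ⟨hYA, hYmax, hYuniq⟩
    rw [hasFDerivAt_iff_isLittleO, Asymptotics.isLittleO_iff]
    intro c hc
    set L := fderiv ℝ (σ (Y z)) u₀ with hL
    have hz1 : 0 < |z| + 1 := by positivity
    have hε : 0 < c / (|z| + 1) := by positivity
    set ε := c / (|z| + 1) with hεdef
    have hεz : |z| * ε ≤ c := by
      rw [hεdef, mul_div_assoc', div_le_iff₀ hz1]
      nlinarith [abs_nonneg z]
    obtain ⟨δ, hδ, hδp⟩ := Metric.continuousOn_iff.1 hσ_grad_cont (Y z, u₀) ⟨hYA, hu₀⟩ ε hε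
    -- mean value estimate
    have hmv : ∀ x ∈ A, dist x (Y z) < δ → ∀ u ∈ Metric.ball u₀ (min δ r),
        |σ x u - σ x u₀ - L (u - u₀)| ≤ ε * ‖u - u₀‖ := by
      intro x hx hxd u hu
      have hbB : ∀ v ∈ Metric.ball u₀ (min δ r), v ∈ B := fun v hv =>
        Metric.mem_closedBall.2 ((Metric.mem_ball.1 hv).le.trans (min_le_right _ _))
      refine (convex_ball u₀ (min δ r)).norm_image_sub_le_of_norm_fderiv_le' (𝕜 := ℝ)
        (fun v hv => hσ_diff x hx v (hrU (hbB v hv))) (fun v hv => ?_)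
        (Metric.mem_ball_self (lt_min hδ hr)) hu
      have := hδp (x, v) ⟨hx, hrU (hbB v hv)⟩ (by
        rw [Prod.dist_eq]
        exact max_lt hxd ((Metric.mem_ball.1 hv).trans_le (min_le_left _ _)))
      rw [dist_eq_norm] at this
      exact this.le
    -- the gap away from the maximizer
    obtain ⟨η, hη, hgap⟩ : ∃ η > 0, ∀ x ∈ A, δ ≤ dist x (Y z) →
        a x + σ x u₀ * z + η ≤ a (Y z) + σ (Y z) u₀ * z := by
      have hKc : IsCompact (A ∩ {x | δ ≤ dist x (Y z)}) :=
        hA_compact.inter_right (isClosed_le continuous_const (by fun_prop))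
      rcases (A ∩ {x | δ ≤ dist x (Y z)}).eq_empty_or_nonempty with he | hne
      · refine ⟨1, one_pos, fun x hx hd => ?_⟩
        have : x ∈ A ∩ {x | δ ≤ dist x (Y z)} := ⟨hx, hd⟩
        rw [he] at this
        exact this.elim
      · obtain ⟨w, ⟨hwA, hwd⟩, hw⟩ := hKc.exists_isMaxOn hne
          ((hfc u₀ hu₀B z).mono Set.inter_subset_left)
        refine ⟨(a (Y z) + σ (Y z) u₀ * z) - (a w + σ w u₀ * z), ?_, fun x hx hd => ?_⟩
        · by_contra hcon
          have : w = Y z := hYuniq w hwA (fun y hy => (hYmax y hy).trans (by linarith))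
          rw [this] at hwd
          simp only [Set.mem_ofPred_eq, dist_self] at hwd
          linarith
        · have h1 : a x + σ x u₀ * z ≤ a w + σ w u₀ * z := hw ⟨hx, hd⟩
          linarith
    have hM0 : sSup ((fun x' => a x' + σ x' u₀ * z) '' A) = a (Y z) + σ (Y z) u₀ * z := by
      obtain ⟨x, hx, h⟩ := voi_sSup_attained hA_compact hA_ne (hfc u₀ hu₀B z)
      exact le_antisymm (h.trans_le (hYmax x hx))
        (voi_sSup_ge hA_compact (hfc u₀ hu₀B z) hYA)
    have hsmall : ∀ᶠ u in nhds u₀, 2 * (C * |z| * ‖u - u₀‖) < η := by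
      have : Continuous fun u => 2 * (C * |z| * ‖u - u₀‖) := by fun_prop
      exact this.continuousAt.eventually_lt_const (by simpa using hη)
    filter_upwards [hsmall, Metric.ball_mem_nhds u₀ (lt_min hδ hr)] with u hus hub
    have huB : u ∈ B :=
      Metric.mem_closedBall.2 ((Metric.mem_ball.1 hub).le.trans (min_le_right _ _))
    obtain ⟨x, hx, hxM⟩ := voi_sSup_attained hA_compact hA_ne (hfc u huB z)
    have hYM := voi_sSup_ge hA_compact (hfc u huB z) hYA
    have hxd : dist x (Y z) < δ := by
      by_contra hcon
      have h1 := hgap x hx (not_lt.1 hcon)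
      have h2 := abs_le.1 (hliz z x hx u huB)
      have h3 := abs_le.1 (hliz z (Y z) hYA u huB)

      linarith [h2.1, h2.2, h3.1, h3.2]
    have hkey : ∀ y ∈ A, dist y (Y z) < δ →
        |(σ y u - σ y u₀ - L (u - u₀)) * z| ≤ c * ‖u - u₀‖ := by
      intro y hy hyd
      rw [abs_mul]
      calc |σ y u - σ y u₀ - L (u - u₀)| * |z| ≤ ε * ‖u - u₀‖ * |z| :=
            mul_le_mul_of_nonneg_right (hmv y hy hyd u hub) (abs_nonneg _)
        _ = |z| * ε * ‖u - u₀‖ := by ring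
        _ ≤ c * ‖u - u₀‖ := mul_le_mul_of_nonneg_right hεz (norm_nonneg _)
    have k1 := abs_le.1 (hkey x hx hxd)
    have k2 := abs_le.1 (hkey (Y z) hYA (by simpa using hδ))
    have hxmax := hYmax x hx

    rw [hM0, Real.norm_eq_abs, abs_le, ContinuousLinearMap.smul_apply, smul_eq_mul]
    rw [hxM] at hYM ⊢
    constructor
    · linarith [k2.1]
    · linarith [k1.2]
end

section
/- Let A ⊆ ℝ^d be a nonempty compact set, let a, s : A → ℝ be continuous, and let (A'_L)_{L≥1} be an increasing sequence of nonempty finite subsets of A whose union ⋃_{L≥1} A'_L is dense in A. Then lim_{L→∞} [ ∫_ℝ max_{x∈A'_L} ( a(x) + s(x)·z ) dγ(z) − max_{x∈A'_L} a(x) ] = ∫_ℝ max_{x∈A} ( a(x) + s(x)·z ) dγ(z) − max_{x∈A} a(x). -/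
open MeasureTheory ProbabilityTheory Filter Topology

theorem voi_aux_sSup {X : Type*} [TopologicalSpace X] (A : Set X)
    (hA_compact : IsCompact A) (hA_ne : A.Nonempty) (f : X → ℝ) (hf : ContinuousOn f A)
    (Q : ℕ → Set X) (hQ_ne : ∀ L, (Q L).Nonempty)
    (hQ_sub : ∀ L, Q L ⊆ A) (hQ_mono : Monotone Q)
    (hQ_dense : A ⊆ closure (⋃ L, Q L)) :
    Tendsto (fun L => sSup (f '' Q L)) atTop (𝓝 (sSup (f '' A))) := by
  have hbdd : BddAbove (f '' A) := hA_compact.bddAbove_image hf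
  have hb : ∀ L, BddAbove (f '' Q L) := fun L => hbdd.mono (Set.image_mono (hQ_sub L))
  have hle : ∀ L, sSup (f '' Q L) ≤ sSup (f '' A) := fun L =>
    csSup_le_csSup hbdd ((hQ_ne L).image f) (Set.image_mono (hQ_sub L))
  refine tendsto_order.2 ⟨fun c hc => ?_, fun c hc => Eventually.of_forall fun L =>
    (hle L).trans_lt hc⟩
  obtain ⟨_, ⟨x, hx, rfl⟩, hcx⟩ := exists_lt_of_lt_csSup (hA_ne.image f) hc
  have h1 : ∀ᶠ y in 𝓝[A] x, c < f y := (hf x hx).eventually (lt_mem_nhds hcx)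
  rw [eventually_nhdsWithin_iff] at h1
  obtain ⟨y, hy, hyQ⟩ := (mem_closure_iff_frequently.1 (hQ_dense hx)).and_eventually h1 |>.exists
  obtain ⟨N, hN⟩ := Set.mem_iUnion.1 hy
  filter_upwards [eventually_ge_atTop N] with L hL
  exact (hyQ (hQ_sub N hN)).trans_le (le_csSup (hb L) ⟨y, hQ_mono hL hN, rfl⟩)

/-- Convergence of the discretized value of information: for `a, s` continuous on a nonempty
compact set `A ⊆ ℝ^d` and an increasing sequence of nonempty finite subsets `Q L ⊆ A` whose
union is dense in `A`,
`∫ max_{x ∈ Q L}(a x + s x · z) dγ(z) − max_{x ∈ Q L} a x` converges, as `L → ∞`, to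
`∫ max_{x ∈ A}(a x + s x · z) dγ(z) − max_{x ∈ A} a x`, where `γ` is the standard Gaussian
measure on `ℝ`. -/
theorem discretized_voi_tendsto
    {d : ℕ} (A : Set (EuclideanSpace ℝ (Fin d)))
    (hA_compact : IsCompact A) (hA_ne : A.Nonempty)
    (a s : EuclideanSpace ℝ (Fin d) → ℝ)
    (ha : ContinuousOn a A) (hs : ContinuousOn s A)
    (Q : ℕ → Set (EuclideanSpace ℝ (Fin d)))
    (hQ_fin : ∀ L, (Q L).Finite) (hQ_ne : ∀ L, (Q L).Nonempty)
    (hQ_sub : ∀ L, Q L ⊆ A) (hQ_mono : Monotone Q)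
    (hQ_dense : A ⊆ closure (⋃ L, Q L)) :
    Tendsto
      (fun L => (∫ z, sSup ((fun x => a x + s x * z) '' Q L) ∂(gaussianReal 0 1))
                  - sSup (a '' Q L))
      atTop
      (𝓝 ((∫ z, sSup ((fun x => a x + s x * z) '' A) ∂(gaussianReal 0 1))
            - sSup (a '' A))) := by
  refine Tendsto.sub ?_ (voi_aux_sSup A hA_compact hA_ne a ha Q hQ_ne hQ_sub hQ_mono hQ_dense)
  obtain ⟨Ca, hCa⟩ := hA_compact.exists_bound_of_continuousOn ha
  obtain ⟨Cs, hCs⟩ := hA_compact.exists_bound_of_continuousOn hs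
  refine tendsto_integral_of_dominated_convergence (fun z => Ca + Cs * |z|) ?_ ?_ ?_ ?_
  · intro L
    have : Countable (Q L) := (hQ_fin L).countable.to_subtype
    simp only [sSup_image']
    refine Measurable.aestronglyMeasurable ?_
    exact Measurable.iSup fun i => by fun_prop
  · have h : Integrable (fun z : ℝ => z) (gaussianReal 0 1) :=
      (memLp_id_gaussianReal (μ := 0) (v := 1) 1).integrable (by simp)
    exact (integrable_const _).add (h.abs.const_mul _)
  · intro L
    refine Eventually.of_forall fun z => ?_
    have key : ∀ x ∈ Q L, |a x + s x * z| ≤ Ca + Cs * |z| := by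
      intro x hx
      have h1 := hCa x (hQ_sub L hx)
      have h2 := hCs x (hQ_sub L hx)
      rw [Real.norm_eq_abs] at h1 h2
      calc |a x + s x * z| ≤ |a x| + |s x * z| := abs_add_le _ _
        _ = |a x| + |s x| * |z| := by rw [abs_mul]
        _ ≤ _ := by gcongr
    have hmem := ((hQ_ne L).image (fun x => a x + s x * z)).csSup_mem ((hQ_fin L).image _)
    obtain ⟨x, hx, hxe⟩ := hmem
    rw [Real.norm_eq_abs, ← hxe]
    exact key x hx
  · refine Eventually.of_forall fun z => ?_
    exact voi_aux_sSup A hA_compact hA_ne (fun x => a x + s x * z)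
      (ha.add (hs.mul continuousOn_const)) Q hQ_ne hQ_sub hQ_mono hQ_dense
end

section
/- Let M ≥ 1 and let a, b, c ∈ ℝ^M satisfy |b_i − b_j| ≤ |c_i − c_j| for all 1 ≤ i, j ≤ M. Then ∫_ℝ max_{1≤i≤M} ( a_i + b_i·z ) dγ(z) ≤ ∫_ℝ max_{1≤i≤M} ( a_i + c_i·z ) dγ(z). -/
open MeasureTheory ProbabilityTheory

lemma integrable_iSup_affine (M : ℕ) (hM : 1 ≤ M) (a b : Fin M → ℝ) :
    Integrable (fun z : ℝ => ⨆ i, a i + b i * z) (gaussianReal 0 1) := by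
  haveI : Nonempty (Fin M) := ⟨⟨0, hM⟩⟩
  have hid : Integrable (fun z : ℝ => z) (gaussianReal 0 1) :=
    (memLp_id_gaussianReal (μ := 0) (v := 1) 1).integrable (by simp)
  have hi : ∀ i, Integrable (fun z : ℝ => a i + b i * z) (gaussianReal 0 1) := fun i =>
    (integrable_const _).add (hid.const_mul _)
  have hb : Integrable (fun z : ℝ => ∑ i, |a i + b i * z|) (gaussianReal 0 1) :=
    integrable_finsetSum _ fun i _ => (hi i).abs
  refine hb.mono' (Measurable.iSup fun i => by fun_prop).aestronglyMeasurable ?_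
  refine Filter.Eventually.of_forall fun z => ?_
  obtain ⟨i, hi⟩ := exists_eq_ciSup_of_finite (f := fun i => a i + b i * z)
  rw [← hi, Real.norm_eq_abs]
  exact Finset.single_le_sum (f := fun i => |a i + b i * z|) (fun _ _ => abs_nonneg _)
    (Finset.mem_univ i)

lemma integral_comp_neg_gaussian (f : ℝ → ℝ) :
    ∫ z, f (-z) ∂(gaussianReal 0 1) = ∫ z, f z ∂(gaussianReal 0 1) := by
  have h : (gaussianReal 0 1).map (fun z : ℝ => -z) = gaussianReal 0 1 := by
    rw [gaussianReal_map_neg]; simp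
  conv_rhs => rw [← h]
  exact ((MeasurableEquiv.neg ℝ).measurableEmbedding.integral_map f).symm

/-- Gaussian comparison inequality (Sudakov–Fernique / Vitale): if the increments of `b` are
dominated by those of `c`, i.e. `|b i - b j| ≤ |c i - c j|` for all `i, j`, then the expected
maximum of `(a i + b i * Z)` is at most that of `(a i + c i * Z)` for `Z` standard normal. -/
theorem gaussian_max_comparison
    (M : ℕ) (hM : 1 ≤ M) (a b c : Fin M → ℝ)
    (h : ∀ i j, |b i - b j| ≤ |c i - c j|) :
    ∫ z, (⨆ i, a i + b i * z) ∂(gaussianReal 0 1) ≤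
      ∫ z, (⨆ i, a i + c i * z) ∂(gaussianReal 0 1) := by
  haveI : Nonempty (Fin M) := ⟨⟨0, hM⟩⟩
  have hneg : ∀ b : Fin M → ℝ,
      Integrable (fun z : ℝ => ⨆ i, a i + b i * (-z)) (gaussianReal 0 1) := fun b => by
    simpa using integrable_iSup_affine M hM a (fun i => -b i)
  have key : ∀ b : Fin M → ℝ, ∫ z, ((⨆ i, a i + b i * z) + ⨆ i, a i + b i * (-z))
      ∂(gaussianReal 0 1) = 2 * ∫ z, (⨆ i, a i + b i * z) ∂(gaussianReal 0 1) := fun b => by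
    rw [integral_add (integrable_iSup_affine M hM a b) (hneg b),
      integral_comp_neg_gaussian (fun z => ⨆ i, a i + b i * z), two_mul]
  have hle : ∫ z, ((⨆ i, a i + b i * z) + ⨆ i, a i + b i * (-z)) ∂(gaussianReal 0 1) ≤
      ∫ z, ((⨆ i, a i + c i * z) + ⨆ i, a i + c i * (-z)) ∂(gaussianReal 0 1) := by
    refine integral_mono ((integrable_iSup_affine M hM a b).add (hneg b))
      ((integrable_iSup_affine M hM a c).add (hneg c)) fun z => ?_
    obtain ⟨i, hi⟩ := exists_eq_ciSup_of_finite (f := fun i => a i + b i * z)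
    obtain ⟨j, hj⟩ := exists_eq_ciSup_of_finite (f := fun i => a i + b i * (-z))
    have hc : ∀ w k, a k + c k * w ≤ ⨆ i, a i + c i * w := fun w k =>
      le_ciSup (f := fun i => a i + c i * w) (Set.finite_range _).bddAbove k
    have h1 : (b i - b j) * z ≤ |(c i - c j) * z| := by
      refine (le_abs_self _).trans ?_
      rw [abs_mul, abs_mul]
      exact mul_le_mul_of_nonneg_right (h i j) (abs_nonneg z)
    show (⨆ i, a i + b i * z) + (⨆ i, a i + b i * (-z)) ≤
      (⨆ i, a i + c i * z) + ⨆ i, a i + c i * (-z)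
    rw [← hi, ← hj]
    have := hc z i
    have := hc z j
    have := hc (-z) i
    have := hc (-z) j
    rcases abs_cases ((c i - c j) * z) with ⟨h2, _⟩ | ⟨h2, _⟩ <;> rw [h2] at h1 <;> linarith
  rw [key, key] at hle
  linarith
end

section
/- Let M ≥ 1 and let a, b ∈ ℝ^M. If ∫_ℝ max_{1≤i≤M} ( a_i + b_i·z ) dγ(z) = max_{1≤i≤M} a_i, then b_i = b_j for all 1 ≤ i, j ≤ M. -/
open MeasureTheory ProbabilityTheory

/-- Rigidity of zero value of information: if the expected maximum of `(a i + b i * Z)`, for `Z`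
standard normal, equals `max_i a i`, then all the coefficients `b i` coincide. -/
theorem gaussian_max_eq_max_implies_const_slope
    (M : ℕ) (hM : 1 ≤ M) (a b : Fin M → ℝ)
    (h : ∫ z, (⨆ i, a i + b i * z) ∂(gaussianReal 0 1) = ⨆ i, a i) :
    ∀ i j, b i = b j := by
  haveI : Nonempty (Fin M) := ⟨⟨0, hM⟩⟩
  obtain ⟨k, hk⟩ := exists_eq_ciSup_of_finite (f := a)
  have hle : ∀ (z : ℝ) (i : Fin M), a i + b i * z ≤ ⨆ i, a i + b i * z := fun z i =>
    le_ciSup (f := fun i => a i + b i * z) (Set.finite_range _).bddAbove i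
  have hid : Integrable (fun z : ℝ => z) (gaussianReal 0 1) :=
    (memLp_id_gaussianReal (μ := 0) (v := 1) 1).integrable (by simp)
  have hlin : ∀ i, Integrable (fun z : ℝ => a i + b i * z) (gaussianReal 0 1) := fun i =>
    (integrable_const _).add (hid.const_mul _)
  have hsup : Integrable (fun z : ℝ => ⨆ i, a i + b i * z) (gaussianReal 0 1) := by
    refine Integrable.mono' (g := fun z => ∑ i, |a i + b i * z|)
      (integrable_finsetSum _ fun i _ => (hlin i).abs) ?_ ?_
    · exact (Measurable.iSup fun i => by fun_prop).aestronglyMeasurable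
    · refine Filter.Eventually.of_forall fun z => ?_
      obtain ⟨j, hj⟩ := exists_eq_ciSup_of_finite (f := fun i => a i + b i * z)
      rw [← hj, Real.norm_eq_abs]
      exact Finset.single_le_sum (f := fun i => |a i + b i * z|)
        (fun i _ => abs_nonneg _) (Finset.mem_univ j)
  have hint : ∫ z, ((⨆ i, a i + b i * z) - (a k + b k * z)) ∂(gaussianReal 0 1) = 0 := by
    rw [integral_sub hsup (hlin k), h, integral_add (integrable_const _) (hid.const_mul _),
      integral_const_mul, integral_id_gaussianReal]
    simp [hk]
  rw [integral_eq_zero_iff_of_nonneg (fun z => sub_nonneg.2 (hle z k)) (hsup.sub (hlin k))] at hint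
  have hvol := (gaussianReal_absolutelyContinuous' 0 (one_ne_zero)).ae_le hint
  have key : ∀ i, b i = b k := by
    intro i
    by_contra hne
    have hd : Dense {z : ℝ | a i + b i * z ≤ a k + b k * z} := by
      apply Measure.dense_of_ae (μ := volume)
      filter_upwards [hvol] with z hz
      have := hle z i
      simp only [Pi.zero_apply] at hz
      linarith
    have hc : IsClosed {z : ℝ | a i + b i * z ≤ a k + b k * z} :=
      isClosed_le (by fun_prop) (by fun_prop)
    have hu := hc.closure_eq ▸ hd.closure_eq
    have hz : (a k - a i + 1) / (b i - b k) ∈ {z : ℝ | a i + b i * z ≤ a k + b k * z} := by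
      rw [hu]; trivial
    have hne' : b i - b k ≠ 0 := sub_ne_zero.2 hne
    have h2 : (b i - b k) * ((a k - a i + 1) / (b i - b k)) = a k - a i + 1 :=
      mul_div_cancel₀ _ hne'
    simp only [Set.mem_setOf_eq] at hz
    linarith
  intro i j
  rw [key i, key j]
end

section
/- Let X be a set, let Σ : X × X → ℝ be a symmetric positive semidefinite kernel, let u ∈ X and λ ≥ 0 with Σ(u, u) + λ > 0, and define Σ'(a, b) := Σ(a, b) − Σ(a, u)·Σ(u, b)/(Σ(u, u) + λ). Then for all x, y ∈ X, Σ'(x, x) + Σ'(y, y) − 2·Σ'(x, y) = Σ(x, x) + Σ(y, y) − 2·Σ(x, y) − (Σ(x, u) − Σ(y, u))²/(Σ(u, u) + λ). In particular, Σ'(x, x) + Σ'(y, y) − 2·Σ'(x, y) ≤ Σ(x, x) + Σ(y, y) − 2·Σ(x, y). -/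
/-- A symmetric positive semidefinite kernel on a set `X`. -/
def IsPSDKernel {X : Type*} (K : X → X → ℝ) : Prop :=
  (∀ a b, K a b = K b a) ∧
    ∀ (k : ℕ) (x : Fin k → X) (c : Fin k → ℝ),
      0 ≤ ∑ i, ∑ j, c i * c j * K (x i) (x j)

/-- The squared canonical metric `d²(x,y) = K x x + K y y - 2 K x y` is non-increasing under the
one-step Gaussian-process posterior covariance update
`K' a b = K a b - K a u * K u b / (K u u + lam)`: in fact
`d'²(x,y) = d²(x,y) - (K x u - K y u)² / (K u u + lam)`. -/
theorem posterior_update_canonical_metric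
    {X : Type*} (K : X → X → ℝ) (hK : IsPSDKernel K)
    (u : X) (lam : ℝ) (hlam : 0 ≤ lam) (hpos : 0 < K u u + lam)
    (x y : X) :
    ((fun a b => K a b - K a u * K u b / (K u u + lam)) x x
        + (fun a b => K a b - K a u * K u b / (K u u + lam)) y y
        - 2 * (fun a b => K a b - K a u * K u b / (K u u + lam)) x y
      = K x x + K y y - 2 * K x y - (K x u - K y u) ^ 2 / (K u u + lam)) ∧
    ((fun a b => K a b - K a u * K u b / (K u u + lam)) x x
        + (fun a b => K a b - K a u * K u b / (K u u + lam)) y y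
        - 2 * (fun a b => K a b - K a u * K u b / (K u u + lam)) x y
      ≤ K x x + K y y - 2 * K x y) := by
  have h : K x x - K x u * K u x / (K u u + lam) + (K y y - K y u * K u y / (K u u + lam))
      - 2 * (K x y - K x u * K u y / (K u u + lam))
      = K x x + K y y - 2 * K x y - (K x u - K y u) ^ 2 / (K u u + lam) := by
    rw [hK.1 u x, hK.1 u y]
    ring
  have h2 : 0 ≤ (K x u - K y u) ^ 2 / (K u u + lam) := div_nonneg (sq_nonneg _) hpos.le
  refine ⟨h, ?_⟩
  show K x x - K x u * K u x / (K u u + lam) + (K y y - K y u * K u y / (K u u + lam))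
      - 2 * (K x y - K x u * K u y / (K u u + lam)) ≤ _
  rw [h]
  linarith
end
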